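/- Let σ′ be a coalitional deviation from an NE assignment σ of an m-server load balancing game in which all m servers participate, and let Ã be any tilde-valid arc subset of the deviation graph's arc set A. Then some server has out-degree 0 in Ã; that is, W₀ = {i : b_i = 0} is nonempty, where b_i is the out-degree of server i in Ã. -/

import Mathlib

/-- The workload of server `i` under assignment `σ`. -/
def load {n m : ℕ} (p : Fin n → ℝ) (σ : Fin n → Fin m) (i : Fin m) : ℝ :=
  ∑ j ∈ Finset.univ.filter (fun j => σ j = i), p j

/-- `σ` is a Nash equilibrium assignment. -/
def IsNE {n m : ℕ} (p : Fin n → ℝ) (σ : Fin n → Fin m) : Prop :=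
  ∀ j i, load p σ (σ j) ≤ load p σ i + p j

/-- `σ'` is a coalitional deviation from `σ`. -/
def IsDeviation {n m : ℕ} (p : Fin n → ℝ) (σ σ' : Fin n → Fin m) : Prop :=
  (∃ j, σ' j ≠ σ j) ∧ ∀ j, σ' j ≠ σ j → load p σ' (σ' j) < load p σ (σ j)

/-- Server `i` participates in the deviation: its job set changes. -/
def Participates {n m : ℕ} (σ σ' : Fin n → Fin m) (i : Fin m) : Prop :=
  {j | σ j = i} ≠ {j | σ' j = i}

/-- `(u,v)` is an arc of the deviation graph. -/
def Arc {n m : ℕ} (σ σ' : Fin n → Fin m) (u v : Fin m) : Prop :=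
  ∃ j, σ' j ≠ σ j ∧ σ j = u ∧ σ' j = v

/-- An arc subset `At ⊆ A` is tilde-valid if every server has exactly one
incoming arc in `At`. -/
def TildeValid {n m : ℕ} (σ σ' : Fin n → Fin m) (At : Finset (Fin m × Fin m)) : Prop :=
  (∀ e ∈ At, Arc σ σ' e.1 e.2) ∧
    ∀ i : Fin m, (At.filter (fun e => e.2 = i)).card = 1

/-- The out-degree `b_i` of server `i` in the arc subset `At`. -/
def outDeg {m : ℕ} (At : Finset (Fin m × Fin m)) (i : Fin m) : ℕ :=
  (At.filter (fun e => e.1 = i)).card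

theorem sum_load {n m : ℕ} (p : Fin n → ℝ) (σ : Fin n → Fin m) :
    ∑ i, load p σ i = ∑ j, p j :=
  Finset.sum_fiberwise _ _ _

/-- Along an arc of the deviation graph, the new workload of the target is below the old workload
of the source. -/
theorem IsDeviation.load_lt {n m : ℕ} {p : Fin n → ℝ} {σ σ' : Fin n → Fin m}
    (hdev : IsDeviation p σ σ') {u v : Fin m} (h : Arc σ σ' u v) :
    load p σ' v < load p σ u := by
  obtain ⟨j, hj, rfl, rfl⟩ := h
  exact hdev.2 j hj

/-- For a coalitional deviation from an NE involving all `m` servers, any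
tilde-valid arc subset leaves some server with out-degree `0`. -/
theorem exists_outdeg_zero {n m : ℕ}
    (p : Fin n → ℝ) (hp : ∀ j, 0 < p j)
    (σ : Fin n → Fin m) (hNE : IsNE p σ)
    (σ' : Fin n → Fin m) (hdev : IsDeviation p σ σ')
    (hall : ∀ i, Participates σ σ' i)
    (At : Finset (Fin m × Fin m)) (htv : TildeValid σ σ' At) :
    ∃ i : Fin m, outDeg At i = 0 := by
  by_contra! hout
  have hin : ∀ i, ∃ u, (u, i) ∈ At := fun i ↦ by
    obtain ⟨⟨u, v⟩, he⟩ := Finset.card_pos.mp (by rw [htv.2 i]; exact one_pos)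
    obtain ⟨hmem, rfl⟩ := Finset.mem_filter.mp he
    exact ⟨u, hmem⟩
  choose f hf using hin
  have hsurj : Function.Surjective f := fun u ↦ by
    obtain ⟨⟨u', v⟩, he⟩ := Finset.card_pos.mp (Nat.pos_of_ne_zero (hout u))
    obtain ⟨hmem, rfl⟩ := Finset.mem_filter.mp he
    have huniq := Finset.card_le_one.mp (htv.2 v).le (f v, v) (by simp [hf v]) (u', v)
      (by simp [hmem])
    exact ⟨v, congrArg Prod.fst huniq⟩
  obtain ⟨j, -⟩ := hdev.1
  have hlt : ∑ i, load p σ' i < ∑ i, load p σ (f i) :=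
    Finset.sum_lt_sum_of_nonempty ⟨σ j, Finset.mem_univ _⟩
      fun i _ ↦ hdev.load_lt (htv.1 _ (hf i))
  rw [(Finite.injective_iff_surjective.mpr hsurj |>.bijective_of_finite).sum_comp (load p σ),
    sum_load, sum_load] at hlt
  exact hlt.false
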